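/- Let X ⊆ ℂⁿ be open. Assume: (i) every d-closed smooth (1,1)-form on X equals dh for some smooth 1-form h on X; (ii) every ∂̄-closed smooth (0,1)-form on X equals ∂̄g for some smooth function g on X; (iii) every ∂-closed smooth (1,0)-form on X equals ∂g for some smooth function g on X. Then every d-closed smooth (1,1)-form f on X can be written f = ∂∂̄v, i.e. f_{jk} = ∂²v/∂z_j∂z̄_k for all j,k, for some smooth function v : X → ℂ. -/

import Mathlib

open Complex

noncomputable section

/-- Wirtinger derivative `∂u/∂z_j` of `u` within the set `X`, at `z`. -/
def wdz {n : ℕ} (X : Set (Fin n → ℂ)) (u : (Fin n → ℂ) → ℂ) (j : Fin n)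
    (z : Fin n → ℂ) : ℂ :=
  (1 / 2 : ℂ) * (fderivWithin ℝ u X z (Pi.single j 1) -
    Complex.I * fderivWithin ℝ u X z (Pi.single j Complex.I))

/-- Wirtinger derivative `∂u/∂z̄_j` of `u` within the set `X`, at `z`. -/
def wdzbar {n : ℕ} (X : Set (Fin n → ℂ)) (u : (Fin n → ℂ) → ℂ) (j : Fin n)
    (z : Fin n → ℂ) : ℂ :=
  (1 / 2 : ℂ) * (fderivWithin ℝ u X z (Pi.single j 1) +
    Complex.I * fderivWithin ℝ u X z (Pi.single j Complex.I))

/-- `∂²u/∂z_j∂z̄_k` within `X`. -/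
def ddbar {n : ℕ} (X : Set (Fin n → ℂ)) (u : (Fin n → ℂ) → ℂ) (j k : Fin n)
    (z : Fin n → ℂ) : ℂ :=
  wdz X (wdzbar X u k) j z

/-- The support of `u` as a function on `X`: the closure in `X` of its nonvanishing set. -/
def suppIn {n : ℕ} (X : Set (Fin n → ℂ)) (u : (Fin n → ℂ) → ℂ) : Set (Fin n → ℂ) :=
  X ∩ closure {z | z ∈ X ∧ u z ≠ 0}

/-- Support of a (1,1)-form given by its coefficient matrix. -/
def supp11 {n : ℕ} (X : Set (Fin n → ℂ)) (T : Fin n → Fin n → (Fin n → ℂ) → ℂ) :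
    Set (Fin n → ℂ) :=
  ⋃ j, ⋃ k, suppIn X (T j k)

/-- Support of a 1-form `Σ a_j dz_j + Σ b_k dz̄_k`. -/
def supp1 {n : ℕ} (X : Set (Fin n → ℂ)) (a b : Fin n → (Fin n → ℂ) → ℂ) :
    Set (Fin n → ℂ) :=
  (⋃ j, suppIn X (a j)) ∪ (⋃ k, suppIn X (b k))

/-- Smoothness of the coefficients of a (1,1)-form on `X`. -/
def Smooth11 {n : ℕ} (X : Set (Fin n → ℂ)) (f : Fin n → Fin n → (Fin n → ℂ) → ℂ) : Prop :=
  ∀ j k, ContDiffOn ℝ (⊤ : ℕ∞) (f j k) X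

/-- A (1,1)-form `Σ f_{jk} dz_j ∧ dz̄_k` is d-closed. -/
def DClosed11 {n : ℕ} (X : Set (Fin n → ℂ)) (f : Fin n → Fin n → (Fin n → ℂ) → ℂ) : Prop :=
  ∀ j k l, ∀ z ∈ X,
    wdz X (f j k) l z = wdz X (f l k) j z ∧ wdzbar X (f j k) l z = wdzbar X (f j l) k z

/-- `d(Σ a_j dz_j + Σ b_k dz̄_k) = f` for a (1,1)-form `f`. -/
def IsDOf {n : ℕ} (X : Set (Fin n → ℂ)) (a b : Fin n → (Fin n → ℂ) → ℂ)
    (f : Fin n → Fin n → (Fin n → ℂ) → ℂ) : Prop :=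
  (∀ j k, ∀ z ∈ X, f j k z = wdz X (b k) j z - wdzbar X (a j) k z) ∧
  (∀ j l, ∀ z ∈ X, wdz X (a j) l z = wdz X (a l) j z) ∧
  (∀ k l, ∀ z ∈ X, wdzbar X (b k) l z = wdzbar X (b l) k z)

/-- A (0,1)-form `Σ b_k dz̄_k` is ∂̄-closed. -/
def DbarClosed01 {n : ℕ} (X : Set (Fin n → ℂ)) (b : Fin n → (Fin n → ℂ) → ℂ) : Prop :=
  ∀ k l, ∀ z ∈ X, wdzbar X (b k) l z = wdzbar X (b l) k z

/-- A (1,0)-form `Σ a_j dz_j` is ∂-closed. -/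
def DClosed10 {n : ℕ} (X : Set (Fin n → ℂ)) (a : Fin n → (Fin n → ℂ) → ℂ) : Prop :=
  ∀ j l, ∀ z ∈ X, wdz X (a j) l z = wdz X (a l) j z

section Wirtinger

variable {n : ℕ} {X : Set (Fin n → ℂ)} {u v : (Fin n → ℂ) → ℂ} {z : Fin n → ℂ}

theorem wdz_congr (h : ∀ y ∈ X, u y = v y) (hz : z ∈ X) (j : Fin n) :
    wdz X u j z = wdz X v j z := by
  simp only [wdz, fderivWithin_congr h (h z hz)]

theorem wdzbar_congr (h : ∀ y ∈ X, u y = v y) (hz : z ∈ X) (j : Fin n) :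
    wdzbar X u j z = wdzbar X v j z := by
  simp only [wdzbar, fderivWithin_congr h (h z hz)]

theorem wdz_sub (hX : IsOpen X) (hu : DifferentiableOn ℝ u X) (hv : DifferentiableOn ℝ v X)
    (hz : z ∈ X) (j : Fin n) :
    wdz X (fun y => u y - v y) j z = wdz X u j z - wdz X v j z := by
  simp only [wdz, fderivWithin_fun_sub (hX.uniqueDiffWithinAt hz) (hu z hz) (hv z hz),
    sub_apply]
  ring

theorem wdzbar_sub (hX : IsOpen X) (hu : DifferentiableOn ℝ u X) (hv : DifferentiableOn ℝ v X)
    (hz : z ∈ X) (j : Fin n) :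
    wdzbar X (fun y => u y - v y) j z = wdzbar X u j z - wdzbar X v j z := by
  simp only [wdzbar, fderivWithin_fun_sub (hX.uniqueDiffWithinAt hz) (hu z hz) (hv z hz),
    sub_apply]
  ring

theorem differentiableOn_fderivWithin_apply (hX : IsOpen X) (hu : ContDiffOn ℝ (⊤ : ℕ∞) u X)
    (a : Fin n → ℂ) : DifferentiableOn ℝ (fun y => fderivWithin ℝ u X y a) X :=
  ((hu.fderivWithin hX.uniqueDiffOn (m := 1) (by norm_cast)).differentiableOn
    one_ne_zero).clm_apply (differentiableOn_const a)

theorem differentiableOn_wdzbar (hX : IsOpen X) (hu : ContDiffOn ℝ (⊤ : ℕ∞) u X) (k : Fin n) :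
    DifferentiableOn ℝ (wdzbar X u k) X :=
  ((differentiableOn_fderivWithin_apply hX hu _).add
    ((differentiableOn_fderivWithin_apply hX hu _).const_mul _)).const_mul _

theorem fderivWithin_fderivWithin_apply_comm (hX : IsOpen X) (hu : ContDiffOn ℝ (⊤ : ℕ∞) u X)
    (hz : z ∈ X) (a b : Fin n → ℂ) :
    fderivWithin ℝ (fun y => fderivWithin ℝ u X y a) X z b =
      fderivWithin ℝ (fun y => fderivWithin ℝ u X y b) X z a := by
  have hd : DifferentiableWithinAt ℝ (fderivWithin ℝ u X) X z :=
    (hu.fderivWithin hX.uniqueDiffOn (m := 1) (by norm_cast)).differentiableOn one_ne_zero z hz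
  have hs : IsSymmSndFDerivWithinAt ℝ u X z :=
    (hu z hz).isSymmSndFDerivWithinAt (by simp; norm_cast) hX.uniqueDiffOn
      (subset_closure (hX.interior_eq.symm ▸ hz)) hz
  have key (c : Fin n → ℂ) := fderivWithin_clm_apply (hX.uniqueDiffWithinAt hz) hd
    (differentiableWithinAt_const (𝕜 := ℝ) (s := X) (x := z) c)
  rw [key a, key b]
  simpa using hs b a

/-- A first-order operator with constant coefficients passes through `fderivWithin`. -/
theorem fderivWithin_const_mul_add_const_mul (hX : IsOpen X) (hu : DifferentiableOn ℝ u X)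
    (hv : DifferentiableOn ℝ v X) (hz : z ∈ X) (c d : ℂ) (a : Fin n → ℂ) :
    fderivWithin ℝ (fun y => c * (u y + d * v y)) X z a =
      c * (fderivWithin ℝ u X z a + d * fderivWithin ℝ v X z a) := by
  have hx := hX.uniqueDiffWithinAt (𝕜 := ℝ) hz
  rw [fderivWithin_const_mul hx ((hu z hz).fun_add ((hv z hz).const_mul d)),
    smul_apply, fderivWithin_fun_add hx (hu z hz) ((hv z hz).const_mul d),
    fderivWithin_const_mul hx (hv z hz)]
  simp

theorem wdzbar_wdz (hX : IsOpen X) (hu : ContDiffOn ℝ (⊤ : ℕ∞) u X) (hz : z ∈ X) (j k : Fin n) :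
    wdzbar X (wdz X u j) k z = ddbar X u j k z := by
  have hD := differentiableOn_fderivWithin_apply hX hu
  have hC := fderivWithin_fderivWithin_apply_comm hX hu hz
  have h₁ : wdz X u j = fun y => (1 / 2 : ℂ) * (fderivWithin ℝ u X y (Pi.single j 1) +
      (-Complex.I) * fderivWithin ℝ u X y (Pi.single j Complex.I)) := by
    funext y
    simp only [wdz]
    ring
  have h₂ : wdzbar X u k = fun y => (1 / 2 : ℂ) * (fderivWithin ℝ u X y (Pi.single k 1) +
      Complex.I * fderivWithin ℝ u X y (Pi.single k Complex.I)) := rfl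
  rw [ddbar, h₁, h₂]
  simp only [wdz, wdzbar, fderivWithin_const_mul_add_const_mul hX (hD _) (hD _) hz]
  rw [hC (Pi.single j 1) (Pi.single k 1), hC (Pi.single j 1) (Pi.single k Complex.I),
    hC (Pi.single j Complex.I) (Pi.single k 1),
    hC (Pi.single j Complex.I) (Pi.single k Complex.I)]
  ring

theorem ddbar_sub (hX : IsOpen X) (hu : ContDiffOn ℝ (⊤ : ℕ∞) u X)
    (hv : ContDiffOn ℝ (⊤ : ℕ∞) v X) (hz : z ∈ X) (j k : Fin n) :
    ddbar X (fun y => u y - v y) j k z = ddbar X u j k z - ddbar X v j k z := by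
  have hne : ((⊤ : ℕ∞) : WithTop ℕ∞) ≠ 0 := by simp
  rw [ddbar, wdz_congr (fun y hy => wdzbar_sub hX (hu.differentiableOn hne)
    (hv.differentiableOn hne) hy k) hz, wdz_sub hX (differentiableOn_wdzbar hX hu k)
    (differentiableOn_wdzbar hX hv k) hz, ddbar, ddbar]

end Wirtinger

/-- If on `X` every d-closed smooth (1,1)-form is `dh`, every ∂̄-closed
smooth (0,1)-form is `∂̄g` and every ∂-closed smooth (1,0)-form is `∂g`, then every
d-closed smooth (1,1)-form `f` on `X` can be written `f = ∂∂̄v` for a smooth `v : X → ℂ`. -/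
theorem stmt7 {n : ℕ} (hn : 0 < n) (X : Set (Fin n → ℂ)) (hX : IsOpen X)
    (hi : ∀ f : Fin n → Fin n → (Fin n → ℂ) → ℂ, Smooth11 X f → DClosed11 X f →
      ∃ a b : Fin n → (Fin n → ℂ) → ℂ,
        (∀ j, ContDiffOn ℝ (⊤ : ℕ∞) (a j) X) ∧ (∀ k, ContDiffOn ℝ (⊤ : ℕ∞) (b k) X) ∧ IsDOf X a b f)
    (hii : ∀ b : Fin n → (Fin n → ℂ) → ℂ, (∀ k, ContDiffOn ℝ (⊤ : ℕ∞) (b k) X) →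
      DbarClosed01 X b →
      ∃ g : (Fin n → ℂ) → ℂ, ContDiffOn ℝ (⊤ : ℕ∞) g X ∧ ∀ k, ∀ z ∈ X, b k z = wdzbar X g k z)
    (hiii : ∀ a : Fin n → (Fin n → ℂ) → ℂ, (∀ j, ContDiffOn ℝ (⊤ : ℕ∞) (a j) X) →
      DClosed10 X a →
      ∃ g : (Fin n → ℂ) → ℂ, ContDiffOn ℝ (⊤ : ℕ∞) g X ∧ ∀ j, ∀ z ∈ X, a j z = wdz X g j z) :
    ∀ f : Fin n → Fin n → (Fin n → ℂ) → ℂ, Smooth11 X f → DClosed11 X f →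
      ∃ v : (Fin n → ℂ) → ℂ, ContDiffOn ℝ (⊤ : ℕ∞) v X ∧
        ∀ j k, ∀ z ∈ X, f j k z = ddbar X v j k z := by
  intro f hf hfc
  obtain ⟨a, b, ha, hb, hab, hac, hbc⟩ := hi f hf hfc
  obtain ⟨g, hg, hbg⟩ := hii b hb hbc
  obtain ⟨g', hg', hag⟩ := hiii a ha hac
  refine ⟨fun y => g y - g' y, hg.sub hg', fun j k z hz => ?_⟩
  rw [hab j k z hz, ddbar_sub hX hg hg' hz, wdz_congr (hbg k) hz, wdzbar_congr (hag j) hz,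
    wdzbar_wdz hX hg' hz]
  rfl
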